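/- arXiv:2603.20710 — 2 statements merged into one kernel-verified Lean document; each statement's English description precedes it below -/
import Mathlib

section
/- Interior inner-product expansion: let T ≥ 1, B ⊆ X, and let f₁, f₂ : ℕ × X → ℝ be supported on Z_T × B. Then for every s with 1 ≤ s ≤ 2T−1 and every t with 0 ≤ t ≤ 2T−s, ⟨U^{f₁}(s,·), U^{f₂}(t,·)⟩_X = Σ_{j=0}^{s−1} [ ⟨f₁(j,·), U^{f₂}(t+s−1−j, ·)⟩_B − ⟨U^{f₁}(j,·), f₂(t+s−1−j, ·)⟩_B ]. -/
open Finset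

/-- The graph Laplacian: `Δu(x) = (1/μ(x)) · Σ_{y∈X} w(x,y)(u(y) − u(x))`. -/
noncomputable def graphLap {X : Type*} [Fintype X] (w : X → X → ℝ) (μ : X → ℝ)
    (u : X → ℝ) (x : X) : ℝ :=
  (1 / μ x) * ∑ y, w x y * (u y - u x)

/-- The solution of the nonhomogeneous graph heat equation with zero initial data:
`U^f(0,x) = 0` and `U^f(t+1,x) = U^f(t,x) + ΔU^f(t,x) + f(t,x)`. -/
noncomputable def heatSol {X : Type*} [Fintype X] (w : X → X → ℝ) (μ : X → ℝ)
    (f : ℕ → X → ℝ) : ℕ → X → ℝ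
  | 0 => fun _ => 0
  | t + 1 => fun x => heatSol w μ f t x + graphLap w μ (heatSol w μ f t) x + f t x

/-- `f : ℕ × X → ℝ` is supported on `Z_T × B`: `f(t,x) = 0` whenever `t ≥ T` or `x ∉ B`. -/
def SuppOn {X : Type*} (T : ℕ) (B : Finset X) (f : ℕ → X → ℝ) : Prop :=
  ∀ t x, (T ≤ t ∨ x ∉ B) → f t x = 0

/-- The graph Laplacian is symmetric for the `μ`-weighted inner product. -/
theorem sum_mul_graphLap_comm {X : Type*} [Fintype X] {w : X → X → ℝ} {μ : X → ℝ}
    (hw : ∀ x y, w x y = w y x) (hμ : ∀ x, μ x ≠ 0) (u v : X → ℝ) :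
    ∑ x, μ x * graphLap w μ u x * v x = ∑ x, μ x * u x * graphLap w μ v x := by
  have hl : ∀ x, μ x * graphLap w μ u x * v x =
      ∑ y, w x y * u y * v x - ∑ y, w x y * u x * v x := fun x => by
    rw [graphLap, ← mul_assoc, mul_one_div_cancel (hμ x), one_mul, sum_mul, ← sum_sub_distrib]
    exact sum_congr rfl fun y _ => by ring
  have hr : ∀ x, μ x * u x * graphLap w μ v x =
      ∑ y, w x y * u x * v y - ∑ y, w x y * u x * v x := fun x => by
    rw [graphLap, mul_right_comm, ← mul_assoc, mul_one_div_cancel (hμ x), one_mul, sum_mul,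
      ← sum_sub_distrib]
    exact sum_congr rfl fun y _ => by ring
  simp only [hl, hr, sum_sub_distrib]
  rw [sum_comm]
  simp only [hw]

/-- Moving one time step from the first heat solution to the second produces source terms only. -/
theorem sum_heatSol_succ_mul {X : Type*} [Fintype X] {w : X → X → ℝ} {μ : X → ℝ}
    (hw : ∀ x y, w x y = w y x) (hμ : ∀ x, μ x ≠ 0) (f₁ f₂ : ℕ → X → ℝ) (s t : ℕ) :
    ∑ x, μ x * heatSol w μ f₁ (s + 1) x * heatSol w μ f₂ t x =
      ∑ x, μ x * heatSol w μ f₁ s x * heatSol w μ f₂ (t + 1) x +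
        (∑ x, μ x * f₁ s x * heatSol w μ f₂ t x - ∑ x, μ x * heatSol w μ f₁ s x * f₂ t x) := by
  have h := sum_mul_graphLap_comm hw hμ (heatSol w μ f₁ s) (heatSol w μ f₂ t)
  simp only [heatSol, mul_add, add_mul, sum_add_distrib]
  rw [h]
  ring

/-- The inner product of two heat solutions, expanded over the whole vertex set. -/
theorem sum_heatSol_mul_heatSol {X : Type*} [Fintype X] {w : X → X → ℝ} {μ : X → ℝ}
    (hw : ∀ x y, w x y = w y x) (hμ : ∀ x, μ x ≠ 0) (f₁ f₂ : ℕ → X → ℝ) (s t : ℕ) :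
    ∑ x, μ x * heatSol w μ f₁ s x * heatSol w μ f₂ t x =
      ∑ j ∈ Finset.range s,
        ((∑ x, μ x * f₁ j x * heatSol w μ f₂ (t + s - 1 - j) x) -
          (∑ x, μ x * heatSol w μ f₁ j x * f₂ (t + s - 1 - j) x)) := by
  induction s generalizing t with
  | zero => simp [heatSol]
  | succ s ih =>
    rw [sum_heatSol_succ_mul hw hμ, ih (t + 1), sum_range_succ]
    have h₁ : t + 1 + s - 1 = t + (s + 1) - 1 := by omega
    have h₂ : t + (s + 1) - 1 - s = t := by omega
    rw [h₁, h₂]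

/-- Interior inner-product expansion: for `1 ≤ s ≤ 2T−1` and `0 ≤ t ≤ 2T−s`,
`⟨U^{f₁}(s,·), U^{f₂}(t,·)⟩_X
  = Σ_{j=0}^{s−1} [⟨f₁(j,·), U^{f₂}(t+s−1−j,·)⟩_B − ⟨U^{f₁}(j,·), f₂(t+s−1−j,·)⟩_B]`. -/
theorem interior_inner_product_expansion {X : Type*} [Fintype X] [Nonempty X]
    (w : X → X → ℝ) (μ : X → ℝ)
    (hw_symm : ∀ x y, w x y = w y x)
    (hw_nonneg : ∀ x y, 0 ≤ w x y)
    (hw_diag : ∀ x, w x x = 0)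
    (hμ : ∀ x, 0 < μ x)
    (T : ℕ) (hT : 1 ≤ T) (B : Finset X)
    (f₁ f₂ : ℕ → X → ℝ) (hf₁ : SuppOn T B f₁) (hf₂ : SuppOn T B f₂)
    (s t : ℕ) (hs1 : 1 ≤ s) (hs2 : s ≤ 2 * T - 1) (ht : t ≤ 2 * T - s) :
    ∑ x, μ x * heatSol w μ f₁ s x * heatSol w μ f₂ t x =
      ∑ j ∈ Finset.range s,
        ((∑ x ∈ B, μ x * f₁ j x * heatSol w μ f₂ (t + s - 1 - j) x) -
          (∑ x ∈ B, μ x * heatSol w μ f₁ j x * f₂ (t + s - 1 - j) x)) := by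
  rw [sum_heatSol_mul_heatSol hw_symm fun x => (hμ x).ne']
  refine sum_congr rfl fun j _ => ?_
  congr 1
  · exact (sum_subset (subset_univ B) fun x _ hx => by simp [hf₁ j x (Or.inr hx)]).symm
  · exact (sum_subset (subset_univ B) fun x _ hx => by simp [hf₂ _ x (Or.inr hx)]).symm
end

section
/- Reconstruction identity for the vertex centrality: let T ≥ 1, B ⊆ X, let φ, ψ : X → ℝ be harmonic on X \ B, and let h₀ : ℕ × X → ℝ be supported on Z_T × B with U^{h₀}(T, x) = ψ(x) for all x ∈ X. Then Σ_{x ∈ X \ B} μ(x) ψ(x) φ(x) = Σ_{j=0}^{T−1} [ ⟨U^{h₀}(j,·), Δφ⟩_B + ⟨h₀(j,·), φ⟩_B ] − Σ_{x ∈ B} μ(x) ψ(x) φ(x). -/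
open Finset

/-- The graph Laplacian is self-adjoint for the inner product weighted by `μ`. -/
lemma sum_graphLap_mul {X : Type*} [Fintype X] (w : X → X → ℝ) (μ : X → ℝ)
    (hw_symm : ∀ x y, w x y = w y x) (hμ : ∀ x, μ x ≠ 0) (u v : X → ℝ) :
    ∑ x, μ x * graphLap w μ u x * v x = ∑ x, μ x * u x * graphLap w μ v x := by
  have hl : ∀ x, μ x * graphLap w μ u x * v x =
      ∑ y, w x y * u y * v x - ∑ y, w x y * u x * v x := by
    intro x
    rw [graphLap, ← mul_assoc, mul_one_div_cancel (hμ x), one_mul, sum_mul, ← sum_sub_distrib]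
    exact sum_congr rfl fun y _ => by ring
  have hr : ∀ x, μ x * u x * graphLap w μ v x =
      ∑ y, w x y * u x * v y - ∑ y, w x y * u x * v x := by
    intro x
    rw [graphLap, mul_right_comm, ← mul_assoc, mul_one_div_cancel (hμ x), one_mul, sum_mul,
      ← sum_sub_distrib]
    exact sum_congr rfl fun y _ => by ring
  simp only [hl, hr, sum_sub_distrib]
  rw [sum_comm]
  simp only [hw_symm]

/-- Duhamel-type formula: the pairing of the heat solution at time `T` with `φ`. -/
lemma sum_heatSol_mul {X : Type*} [Fintype X] (w : X → X → ℝ) (μ : X → ℝ)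
    (hw_symm : ∀ x y, w x y = w y x) (hμ : ∀ x, μ x ≠ 0) (f : ℕ → X → ℝ) (φ : X → ℝ) (T : ℕ) :
    ∑ x, μ x * heatSol w μ f T x * φ x =
      ∑ j ∈ range T, ((∑ x, μ x * heatSol w μ f j x * graphLap w μ φ x) +
        ∑ x, μ x * f j x * φ x) := by
  induction T with
  | zero => simp [heatSol]
  | succ T ih =>
    rw [sum_range_succ, ← ih, ← sum_graphLap_mul w μ hw_symm hμ, ← sum_add_distrib,
      ← sum_add_distrib]
    refine sum_congr rfl fun x _ => ?_
    rw [heatSol]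
    ring

/-- Reconstruction identity for the vertex centrality: if `φ, ψ` are harmonic on `X \ B`
and `h₀` is a control supported on `Z_T × B` with `U^{h₀}(T,·) = ψ`, then
`Σ_{x∈X\B} μ(x) ψ(x) φ(x)
  = Σ_{j=0}^{T−1} [⟨U^{h₀}(j,·), Δφ⟩_B + ⟨h₀(j,·), φ⟩_B] − Σ_{x∈B} μ(x) ψ(x) φ(x)`. -/
theorem reconstruction_identity {X : Type*} [Fintype X] [DecidableEq X] [Nonempty X]
    (w : X → X → ℝ) (μ : X → ℝ)
    (hw_symm : ∀ x y, w x y = w y x)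
    (hw_nonneg : ∀ x y, 0 ≤ w x y)
    (hw_diag : ∀ x, w x x = 0)
    (hμ : ∀ x, 0 < μ x)
    (T : ℕ) (hT : 1 ≤ T) (B : Finset X)
    (φ ψ : X → ℝ)
    (hφ : ∀ x, x ∉ B → graphLap w μ φ x = 0)
    (hψ : ∀ x, x ∉ B → graphLap w μ ψ x = 0)
    (h₀ : ℕ → X → ℝ) (hh₀ : SuppOn T B h₀)
    (hctrl : ∀ x, heatSol w μ h₀ T x = ψ x) :
    ∑ x ∈ Bᶜ, μ x * ψ x * φ x =
      (∑ j ∈ Finset.range T,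
        ((∑ x ∈ B, μ x * heatSol w μ h₀ j x * graphLap w μ φ x) +
          (∑ x ∈ B, μ x * h₀ j x * φ x))) -
      ∑ x ∈ B, μ x * ψ x * φ x := by
  rw [eq_sub_iff_add_eq, sum_compl_add_sum]
  simp only [← hctrl]
  rw [sum_heatSol_mul w μ hw_symm fun x => (hμ x).ne']
  refine sum_congr rfl fun j _ => ?_
  congr 1
  · refine (sum_subset (subset_univ B) fun x _ hx => ?_).symm
    rw [hφ x hx, mul_zero]
  · refine (sum_subset (subset_univ B) fun x _ hx => ?_).symm
    rw [hh₀ j x (Or.inr hx), mul_zero, zero_mul]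
end
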